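/- Let A_0, ..., A_n be nonempty finite subsets of a lattice M of rank n, with unique essential subfamily indexed by J (so the sparse eliminant Elim ≠ 1). Then for an index i, the partial degree of Elim in the variables u_i is positive if and only if i belongs to J. Equivalently, the variables u_i with i not in J do not appear in Elim. -/

import Mathlib

open Pointwise MeasureTheory

noncomputable section

variable {n : ℕ}

/-- Evaluation of the character `χ^a` at a point `ξ` of the torus `(ℂˣ)^n`. -/
def chEval (ξ : Fin n → ℂˣ) (a : Fin n → ℤ) : ℂ :=
  ∏ j, ((ξ j ^ (a j) : ℂˣ) : ℂ)

/-- `ξ` is a common root of the Laurent polynomials with supports `A i` and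
coefficients `c i`. -/
def IsRootOf (A : Fin (n + 1) → Finset (Fin n → ℤ))
    (c : Fin (n + 1) → (Fin n → ℤ) → ℂ) (ξ : Fin n → ℂˣ) : Prop :=
  ∀ i, ∑ a ∈ A i, c i a * chEval ξ a = 0

/-- The family with supports `A` and coefficients `c` has a common root in the torus. -/
def HasRoot (A : Fin (n + 1) → Finset (Fin n → ℤ))
    (c : Fin (n + 1) → (Fin n → ℤ) → ℂ) : Prop :=
  ∃ ξ, IsRootOf A c ξ

/-- Evaluation of an integer polynomial in the coefficient variables `u_{i,a}` at a
family of complex coefficients. -/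
def evalCoeff (R : MvPolynomial (Fin (n + 1) × (Fin n → ℤ)) ℤ)
    (c : Fin (n + 1) → (Fin n → ℤ) → ℂ) : ℂ :=
  MvPolynomial.aeval (fun p => c p.1 p.2) R

/-- `E` is the sparse eliminant of the family of supports `A`. -/
def IsEliminant (A : Fin (n + 1) → Finset (Fin n → ℤ))
    (E : MvPolynomial (Fin (n + 1) × (Fin n → ℤ)) ℤ) : Prop :=
  (Irreducible E ∧ {c | evalCoeff E c = 0} = closure {c | HasRoot A c})
  ∨ (E = 1 ∧ ∀ E' : MvPolynomial (Fin (n + 1) × (Fin n → ℤ)) ℤ,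
      ¬ (Irreducible E' ∧ {c | evalCoeff E' c = 0} = closure {c | HasRoot A c}))

/-- `R` is the sparse resultant of the family of supports `A`: up to sign the power
`E^d` of the sparse eliminant, where `d` is the degree of the projection from the
incidence variety (the number of common roots of a generic coefficient family in the
vanishing locus). -/
def IsResultant (A : Fin (n + 1) → Finset (Fin n → ℤ))
    (R : MvPolynomial (Fin (n + 1) × (Fin n → ℤ)) ℤ) : Prop :=
  ∃ E d, IsEliminant A E ∧ (R = E ^ d ∨ R = -E ^ d) ∧
    ∃ U : Set (Fin (n + 1) → (Fin n → ℤ) → ℂ), IsOpen U ∧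
      closure (U ∩ {c | HasRoot A c}) = closure {c | HasRoot A c} ∧
      ∀ c ∈ U ∩ {c | HasRoot A c}, Nat.card {ξ // IsRootOf A c ξ} = d

/-- The partial degree of `R` in the group of variables `u_i = (u_{i,a})_a`. -/
def groupDeg (i : Fin (n + 1)) (R : MvPolynomial (Fin (n + 1) × (Fin n → ℤ)) ℤ) : ℕ :=
  R.support.sup fun m => ∑ p ∈ m.support.filter (fun p => p.1 = i), m p

/-- Mixed volume (inclusion-exclusion formula, normalized by `MV(Q,…,Q) = k! vol Q`),
with the convention `MV = 1` for `k = 0`. -/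
def mixedVolume (k : ℕ) {ι : Type*} [Fintype ι] (Q : ι → Set (Fin k → ℝ)) : ℝ :=
  if k = 0 then 1 else
    ∑ s ∈ (Finset.univ : Finset ι).powerset,
      if s.Nonempty then
        (-1 : ℝ) ^ (Fintype.card ι - s.card) * (volume (∑ i ∈ s, Q i)).toReal
      else 0

/-- The coordinatewise cast `ℤ^n → ℝ^n`. -/
def castR (n : ℕ) (x : Fin n → ℤ) : Fin n → ℝ := fun j => (x j : ℝ)


/-- The "difference lattice" of a finite subset `A` of a lattice: the subgroup
generated by all differences of elements of `A`. -/
def diffLattice {M : Type*} [AddCommGroup M] (A : Finset M) : Submodule ℤ M :=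
  Submodule.span ℤ {x | ∃ a ∈ A, ∃ b ∈ A, x = a - b}

/-- A subfamily indexed by `J` is *essential* if `#J = rank(L_J) + 1` and
`#J' ≤ rank(L_{J'})` for every proper subset `J'` of `J`. -/
def IsEssential {M : Type*} [AddCommGroup M] {κ : Type*} (A : κ → Finset M)
    (J : Finset κ) : Prop :=
  J.card = Module.finrank ℤ ↥(∑ j ∈ J, diffLattice (A j)) + 1 ∧
  ∀ J' ⊂ J, J'.card ≤ Module.finrank ℤ ↥(∑ j ∈ J', diffLattice (A j))

lemma Polynomial.eval₂_intCast_eq {R S : Type*} [CommRing R] [CommRing S] (f : R →+* S) (t : S)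
    (k : ℤ) : (k : Polynomial R).eval₂ f t = k :=
  map_intCast (Polynomial.eval₂RingHom f t) k

open Polynomial in
/-- The substitution `X p ↦ X p + v p • T`, restricting a polynomial to a generic line of
direction `v`. -/
def lineShift {σ : Type*} (v : σ → ℤ) : MvPolynomial σ ℤ →+* (MvPolynomial σ ℤ)[X] :=
  MvPolynomial.eval₂Hom (Int.castRingHom _) fun p =>
    C (MvPolynomial.X p) + C (v p : MvPolynomial σ ℤ) * X

open Polynomial in
@[simp] lemma lineShift_X {σ : Type*} (v : σ → ℤ) (p : σ) :
    lineShift v (MvPolynomial.X p) =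
      C (MvPolynomial.X p) + C (v p : MvPolynomial σ ℤ) * X := by
  simp [lineShift]

open Polynomial in
/-- The automorphism of `ℤ[σ][T]` fixing `T` and extending `lineShift v`. -/
def lineShiftEquiv {σ : Type*} (v : σ → ℤ) : (MvPolynomial σ ℤ)[X] ≃+* (MvPolynomial σ ℤ)[X] :=
  RingEquiv.ofRingHom (Polynomial.eval₂RingHom (lineShift v) X)
    (Polynomial.eval₂RingHom (lineShift (-v)) X)
    (by
      apply Polynomial.ringHom_ext'
      · apply MvPolynomial.ringHom_ext <;> intros <;> simp [eval₂_intCast_eq, add_assoc, ← add_mul]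
      · simp)
    (by
      apply Polynomial.ringHom_ext'
      · apply MvPolynomial.ringHom_ext <;> intros <;> simp [eval₂_intCast_eq, add_assoc, ← add_mul]
      · simp)

lemma lineShiftEquiv_C {σ : Type*} (v : σ → ℤ) (F : MvPolynomial σ ℤ) :
    lineShiftEquiv v (Polynomial.C F) = lineShift v F := by
  simp [lineShiftEquiv]

open Polynomial in
/-- A prime polynomial of positive degree over a domain and a polynomial it does not divide
have a nonzero constant in the ideal they generate. -/
lemma Polynomial.exists_bezout_of_prime {R : Type*} [CommRing R] [IsDomain R]
    [UniqueFactorizationMonoid R] {f g : R[X]} (hf : Prime f) (hfg : ¬ f ∣ g) :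
    ∃ (a b : R[X]) (r : R), r ≠ 0 ∧ a * f + b * g = C r := by
  by_cases hd : f.natDegree = 0
  · rw [Polynomial.natDegree_eq_zero] at hd
    obtain ⟨r, rfl⟩ := hd
    exact ⟨1, 0, r, by rintro rfl; simp at hf, by simp⟩
  let : NormalizedGCDMonoid R :=
    Classical.choice (inferInstance : Nonempty (NormalizedGCDMonoid R))
  let K := FractionRing R
  have hinj : Function.Injective (algebraMap R K) := IsFractionRing.injective R K
  have hprim := hf.irreducible.isPrimitive hd
  have hirr : Irreducible (f.map (algebraMap R K)) :=
    (hprim.irreducible_iff_irreducible_map_fraction_map (K := K)).1 hf.irreducible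
  have hclear : ∀ q : K[X], ∃ (c : R) (q' : R[X]), c ≠ 0 ∧
      q'.map (algebraMap R K) = C (algebraMap R K c) * q := by
    intro q
    obtain ⟨c, hcm, hc⟩ := IsLocalization.integerNormalization_spec (nonZeroDivisors R) q
    refine ⟨c, _, nonZeroDivisors.ne_zero hcm, hc.trans ?_⟩
    ext; simp [Algebra.smul_def]
  have hcop : IsCoprime (f.map (algebraMap R K)) (g.map (algebraMap R K)) := by
    refine (hirr.coprime_iff_not_dvd).2 ?_
    rintro ⟨q, hq⟩
    obtain ⟨c, q', hc, hq'⟩ := hclear q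
    have h : C c * g = f * q' := by
      apply Polynomial.map_injective _ hinj
      rw [Polynomial.map_mul, Polynomial.map_mul, hq', hq, Polynomial.map_C]
      ring
    rcases hf.dvd_or_dvd ⟨q', h⟩ with h | h
    · have := Polynomial.natDegree_le_of_dvd h (by simpa using hc)
      simp at this
      exact hd this
    · exact hfg h
  obtain ⟨a, b, hab⟩ := hcop
  obtain ⟨ca, a', hca, ha⟩ := hclear a
  obtain ⟨cb, b', hcb, hb⟩ := hclear b
  refine ⟨C cb * a', C ca * b', ca * cb, mul_ne_zero hca hcb, ?_⟩
  apply Polynomial.map_injective _ hinj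
  simp only [Polynomial.map_mul, Polynomial.map_add, ha, hb, Polynomial.map_C, map_mul]
  linear_combination C (algebraMap R K ca) * C (algebraMap R K cb) * hab

open Polynomial in
lemma exists_lineShift_bezout {σ : Type*} {E G : MvPolynomial σ ℤ} (hE : Irreducible E)
    (hEG : ¬ E ∣ G) (v : σ → ℤ) :
    ∃ (a b : (MvPolynomial σ ℤ)[X]) (r : MvPolynomial σ ℤ), r ≠ 0 ∧
      a * lineShift v E + b * lineShift v G = C r := by
  apply Polynomial.exists_bezout_of_prime
  · rw [← lineShiftEquiv_C, MulEquiv.prime_iff (lineShiftEquiv v), Polynomial.prime_C_iff]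
    exact hE.prime
  · rw [← lineShiftEquiv_C, ← lineShiftEquiv_C, map_dvd_iff]
    intro h
    rw [Polynomial.C_dvd_iff_dvd_coeff] at h
    exact hEG (by simpa using h 0)

/-- Evaluating `lineShift v F` at a base point `y` and a parameter `t`. -/
lemma eval₂_lineShift {σ R : Type*} [CommRing R] (v : σ → ℤ) (F : MvPolynomial σ ℤ)
    (f : MvPolynomial σ ℤ →+* R) (t : R) :
    (lineShift v F).eval₂ f t = MvPolynomial.aeval (fun p => f (MvPolynomial.X p) + v p * t) F := by
  have : (Polynomial.eval₂RingHom f t).comp (lineShift v) =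
      (MvPolynomial.aeval (fun p => f (MvPolynomial.X p) + v p * t)).toRingHom := by
    apply MvPolynomial.ringHom_ext <;> intros <;> simp [Polynomial.eval₂_intCast_eq]
  exact congrArg (fun g => g F) this

open Polynomial in
lemma Polynomial.natDegree_prod_le_and_coeff_prod {ι R : Type*} [CommRing R] (s : Finset ι)
    (f : ι → R[X]) (k : ι → ℕ) (c : ι → R)
    (h : ∀ i ∈ s, (f i).natDegree ≤ k i ∧ (f i).coeff (k i) = c i) :
    (∏ i ∈ s, f i).natDegree ≤ ∑ i ∈ s, k i ∧
      (∏ i ∈ s, f i).coeff (∑ i ∈ s, k i) = ∏ i ∈ s, c i := by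
  classical
  induction s using Finset.induction_on with
  | empty => simp
  | insert a s ha ih =>
    obtain ⟨h1, h2⟩ := h a (Finset.mem_insert_self _ _)
    obtain ⟨h3, h4⟩ := ih fun i hi => h i (Finset.mem_insert_of_mem hi)
    rw [Finset.prod_insert ha, Finset.sum_insert ha, Finset.prod_insert ha]
    exact ⟨Polynomial.natDegree_mul_le_of_le h1 h3,
      by rw [Polynomial.coeff_mul_add_eq_of_natDegree_le h1 h3, h2, h4]⟩

open Polynomial in
lemma exists_lineShift_coeff_eq_intCast {σ : Type*} {E : MvPolynomial σ ℤ} (hE : E ≠ 0) :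
    ∃ (v : σ → ℤ) (e : ℤ), e ≠ 0 ∧ (lineShift v E).natDegree ≤ E.totalDegree ∧
      (lineShift v E).coeff E.totalDegree = e := by
  have hne : MvPolynomial.homogeneousComponent E.totalDegree E ≠ 0 := by
    obtain ⟨m, hm, hmd⟩ : ∃ m ∈ E.support, E.totalDegree = m.degree := by
      obtain ⟨m, hm, h⟩ := Finset.exists_mem_eq_sup E.support (by simpa using hE)
        (fun m => m.sum fun _ e => e)
      exact ⟨m, hm, h⟩
    intro h
    have := congrArg (MvPolynomial.coeff m) h
    rw [MvPolynomial.coeff_homogeneousComponent, if_pos hmd.symm] at this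
    exact (MvPolynomial.mem_support_iff.1 hm) this
  obtain ⟨v, hv⟩ : ∃ v : σ → ℤ,
      MvPolynomial.eval v (MvPolynomial.homogeneousComponent E.totalDegree E) ≠ 0 := by
    by_contra! h
    exact hne (MvPolynomial.funext (by simpa using h))
  have hlin : ∀ p, (C (MvPolynomial.X p : MvPolynomial σ ℤ) +
      C (v p : MvPolynomial σ ℤ) * X).natDegree ≤ 1 := by
    intro p
    compute_degree
  have hprod : ∀ m : σ →₀ ℕ,
      (m.prod fun p k => (C (MvPolynomial.X p : MvPolynomial σ ℤ) +
        C (v p : MvPolynomial σ ℤ) * X) ^ k).natDegree ≤ m.degree ∧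
      (m.prod fun p k => (C (MvPolynomial.X p : MvPolynomial σ ℤ) +
        C (v p : MvPolynomial σ ℤ) * X) ^ k).coeff m.degree =
          m.prod fun p k => (v p : MvPolynomial σ ℤ) ^ k := by
    intro m
    refine Polynomial.natDegree_prod_le_and_coeff_prod _ _ _ _ fun p _ => ⟨?_, ?_⟩
    · exact (Polynomial.natDegree_pow_le_of_le _ (hlin p)).trans (by simp)
    · have := Polynomial.coeff_pow_of_natDegree_le (m := m p) (hlin p)
      simpa using this
  have hsum : lineShift v E = ∑ m ∈ E.support,
      ((MvPolynomial.coeff m E : ℤ) : (MvPolynomial σ ℤ)[X]) *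
      (m.prod fun p k => (C (MvPolynomial.X p : MvPolynomial σ ℤ) +
        C (v p : MvPolynomial σ ℤ) * X) ^ k) := by
    rw [lineShift, MvPolynomial.coe_eval₂Hom, MvPolynomial.eval₂_eq]
    rfl
  have hdeg : ∀ m ∈ E.support, m.degree ≤ E.totalDegree := fun m hm =>
    MvPolynomial.le_totalDegree hm
  refine ⟨v, _, hv, ?_, ?_⟩
  · rw [hsum]
    refine Polynomial.natDegree_sum_le_of_forall_le _ _ fun m hm => ?_
    rw [← Polynomial.C_eq_intCast]
    exact (Polynomial.natDegree_C_mul_le _ _).trans ((hprod m).1.trans (hdeg m hm))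
  · rw [hsum, Polynomial.finsetSum_coeff, MvPolynomial.homogeneousComponent_apply, map_sum,
      Int.cast_sum, Finset.sum_filter]
    refine Finset.sum_congr rfl fun m hm => ?_
    rw [← Polynomial.C_eq_intCast, Polynomial.coeff_C_mul]
    split_ifs with h
    · rw [← h, (hprod m).2, MvPolynomial.eval_monomial]
      simp [Finsupp.prod]
    · rw [Polynomial.coeff_eq_zero_of_natDegree_lt, mul_zero]
      exact (hprod m).1.trans_lt (lt_of_le_of_ne (hdeg m hm) h)

lemma Multiset.pow_card_le_prod_map {α : Type*} (s : Multiset α) (g : α → ℝ) {r : ℝ} (hr : 0 ≤ r)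
    (h : ∀ x ∈ s, r ≤ g x) : r ^ s.card ≤ (s.map g).prod := by
  induction s using Multiset.induction_on with
  | empty => simp
  | cons a s ih =>
    have h1 := h a (Multiset.mem_cons_self _ _)
    have h2 := ih fun x hx => h x (Multiset.mem_cons_of_mem hx)
    rw [Multiset.card_cons, Multiset.map_cons, Multiset.prod_cons, pow_succ']
    exact mul_le_mul h1 h2 (by positivity) (hr.trans h1)

/-- A nonconstant complex polynomial has a root whose modulus is controlled by its leading and
constant coefficients. -/
lemma Polynomial.exists_isRoot_norm_pow_le {q : Polynomial ℂ} (hq : 0 < q.natDegree) :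
    ∃ z, q.IsRoot z ∧ ‖z‖ ^ q.natDegree * ‖q.leadingCoeff‖ ≤ ‖q.coeff 0‖ := by
  classical
  have hq0 : q ≠ 0 := by rintro rfl; simp at hq
  have hsp := IsAlgClosed.splits q
  have hcard : q.roots.card = q.natDegree := hsp.natDegree_eq_card_roots.symm
  obtain ⟨z, hz, hmin⟩ := q.roots.toFinset.exists_min_image (fun z => ‖z‖) (by
    obtain ⟨z, hz⟩ := Multiset.card_pos_iff_exists_mem.1 (hcard ▸ hq)
    exact ⟨z, Multiset.mem_toFinset.2 hz⟩)
  refine ⟨z, (Polynomial.mem_roots hq0).1 (Multiset.mem_toFinset.1 hz), ?_⟩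
  have h := Multiset.pow_card_le_prod_map q.roots (fun w => ‖w‖) (norm_nonneg z)
    fun w hw => hmin w (Multiset.mem_toFinset.2 hw)
  have hcoeff : ‖q.coeff 0‖ = ‖q.leadingCoeff‖ * (q.roots.map fun w => ‖w‖).prod := by
    rw [hsp.coeff_zero_eq_leadingCoeff_mul_prod_roots, norm_mul, norm_mul, norm_pow, norm_neg,
      norm_one, one_pow, one_mul]
    exact congrArg _ (Multiset.prod_hom q.roots (normHom : ℂ →*₀ ℝ)).symm
  rw [hcoeff, mul_comm, ← hcard]
  gcongr

/-- The points of the hypersurface `E = 0` off the hypersurface `G = 0` are dense in the former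
as soon as `E` is irreducible over `ℤ` and does not divide `G`. -/
lemma exists_seq_tendsto_of_not_dvd {σ : Type*} {E G : MvPolynomial σ ℤ} (hE : Irreducible E)
    (hEG : ¬ E ∣ G) (c : σ → ℂ) (hc : MvPolynomial.aeval c E = 0) :
    ∃ x : ℕ → σ → ℂ, Filter.Tendsto x Filter.atTop (nhds c) ∧
      ∀ k, MvPolynomial.aeval (x k) E = 0 ∧ MvPolynomial.aeval (x k) G ≠ 0 := by
  obtain ⟨v, e, he, hdeg, hcoeff⟩ := exists_lineShift_coeff_eq_intCast hE.ne_zero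
  obtain ⟨a, b, r, hr, hab⟩ := exists_lineShift_bezout hE hEG v
  have hd : 0 < E.totalDegree := by
    rw [Nat.pos_iff_ne_zero]
    intro h0
    rw [MvPolynomial.totalDegree_eq_zero_iff_eq_C] at h0
    rw [h0, MvPolynomial.aeval_C] at hc
    have hc' : MvPolynomial.coeff 0 E = 0 := by simpa using hc
    rw [hc'] at h0
    exact hE.ne_zero (by simpa using h0)
  have hy : ∀ k : ℕ, ∃ y : σ → ℂ, (∀ p, dist (y p) (c p) < 1 / ((k : ℝ) + 1)) ∧
      MvPolynomial.aeval y r ≠ 0 := by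
    intro k
    by_contra! h
    apply hr
    apply MvPolynomial.map_injective (Int.castRingHom ℂ) Int.cast_injective
    apply MvPolynomial.funext_set (fun p => Metric.ball (c p) (1 / ((k : ℝ) + 1)))
    · intro p
      exact infinite_of_mem_nhds (c p) (Metric.ball_mem_nhds _ (by positivity))
    · intro y hyc
      have := h y (fun p => by simpa using hyc p (Set.mem_univ p))
      rw [MvPolynomial.eval_map, map_zero, map_zero]
      simpa [MvPolynomial.aeval_def] using this
  choose y hyc hyr using hy
  have hyt : Filter.Tendsto y Filter.atTop (nhds c) := by
    rw [tendsto_pi_nhds]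
    intro p
    rw [tendsto_iff_dist_tendsto_zero]
    exact squeeze_zero (fun _ => dist_nonneg) (fun k => (hyc k p).le)
      tendsto_one_div_add_atTop_nhds_zero_nat
  have hline : ∀ (k : ℕ) (F : MvPolynomial σ ℤ) (t : ℂ),
      ((lineShift v F).map (MvPolynomial.aeval (y k)).toRingHom).eval t =
        MvPolynomial.aeval (fun p => y k p + v p * t) F := by
    intro k F t
    rw [Polynomial.eval_map, eval₂_lineShift]
    simp
  have hroot : ∀ k, ∃ t : ℂ, MvPolynomial.aeval (fun p => y k p + v p * t) E = 0 ∧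
      ‖t‖ ^ E.totalDegree * ‖(e : ℂ)‖ ≤ ‖MvPolynomial.aeval (y k) E‖ := by
    intro k
    set q := (lineShift v E).map (MvPolynomial.aeval (y k)).toRingHom with hq
    have hqc : q.coeff E.totalDegree = e := by
      rw [hq, Polynomial.coeff_map, hcoeff]
      simp
    have hqd : q.natDegree = E.totalDegree := by
      apply Polynomial.natDegree_eq_of_le_of_coeff_ne_zero
      · exact Polynomial.natDegree_map_le.trans hdeg
      · rw [hqc]
        exact_mod_cast he
    obtain ⟨t, ht, htn⟩ := Polynomial.exists_isRoot_norm_pow_le (q := q) (by omega)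
    refine ⟨t, by rw [← hline]; exact ht, ?_⟩
    rw [Polynomial.leadingCoeff, hqd, hqc, Polynomial.coeff_zero_eq_eval_zero, hq, hline] at htn
    simpa using htn
  choose t ht htn using hroot
  have hEt : Filter.Tendsto (fun k => ‖MvPolynomial.aeval (y k) E‖) Filter.atTop (nhds 0) := by
    have hcont : Continuous fun z : σ → ℂ => MvPolynomial.aeval z E := by
      have := MvPolynomial.continuous_eval (E.map (Int.castRingHom ℂ))
      simpa [MvPolynomial.eval_map, MvPolynomial.aeval_def] using this
    have := ((hcont.tendsto c).comp hyt).norm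
    simpa [hc] using this
  have htt : Filter.Tendsto t Filter.atTop (nhds 0) := by
    have he' : 0 < ‖(e : ℂ)‖ := by simpa using he
    have hpow : Filter.Tendsto (fun k => ‖t k‖ ^ E.totalDegree) Filter.atTop (nhds 0) := by
      refine squeeze_zero (fun _ => by positivity) (fun k => (le_div_iff₀ he').2 (htn k)) ?_
      simpa using hEt.div_const ‖(e : ℂ)‖
    rw [tendsto_zero_iff_norm_tendsto_zero]
    have := hpow.rpow_const (p := (E.totalDegree : ℝ)⁻¹) (Or.inr (by positivity))
    rw [Real.zero_rpow (by positivity)] at this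
    refine this.congr fun k => ?_
    exact Real.pow_rpow_inv_natCast (norm_nonneg _) hd.ne'
  refine ⟨fun k p => y k p + v p * t k, ?_, fun k => ⟨ht k, fun hG => hyr k ?_⟩⟩
  · rw [tendsto_pi_nhds] at hyt ⊢
    intro p
    simpa using (hyt p).add (htt.const_mul (v p : ℂ))
  · have := congrArg (fun P => (P.map (MvPolynomial.aeval (y k)).toRingHom).eval (t k)) hab
    simp only [Polynomial.map_add, Polynomial.map_mul, Polynomial.eval_add, Polynomial.eval_mul,
      hline, ht k, hG, mul_zero, add_zero, Polynomial.map_C, Polynomial.eval_C] at this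
    exact this.symm

/-- **Zariski's lemma** for complex points of algebras over a subfield of `ℂ`. -/
lemma exists_ringHom_comp_algebraMap_eq_of_field {K T : Type*} [Field K] [CommRing T]
    [Nontrivial T] [Algebra K T] [Algebra.FiniteType K T] (l : K →+* ℂ) :
    ∃ L : T →+* ℂ, L.comp (algebraMap K T) = l := by
  obtain ⟨m, hm⟩ := Ideal.exists_maximal T
  let := Ideal.Quotient.field m
  have : Module.Finite K (T ⧸ m) := finite_of_finite_type_of_isJacobsonRing _ _
  let := l.toAlgebra
  let L : (T ⧸ m) →ₐ[K] ℂ := IsAlgClosed.lift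
  refine ⟨(L : T ⧸ m →+* ℂ).comp (Ideal.Quotient.mk m), ?_⟩
  ext x
  exact L.commutes x

open TensorProduct in
/-- A complex point of `Spec A` lying in the image of `Spec B` lifts to a complex point of `B`. -/
lemma exists_ringHom_comp_algebraMap_eq {A B : Type*} [CommRing A] [CommRing B] [Algebra A B]
    [Algebra.FiniteType A B] (c : A →+* ℂ)
    (hc : (⟨RingHom.ker c, RingHom.ker_isPrime c⟩ : PrimeSpectrum A) ∈
      Set.range (PrimeSpectrum.comap (algebraMap A B))) :
    ∃ θ : B →+* ℂ, θ.comp (algebraMap A B) = c := by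
  have := RingHom.ker_isPrime c
  rw [← PrimeSpectrum.nontrivial_iff_mem_rangeComap] at hc
  let K := (RingHom.ker c).ResidueField
  have : Nontrivial (K ⊗[A] B) := hc
  let l : K →+* ℂ := Ideal.ResidueField.lift _ c le_rfl
    (fun x hx => (isUnit_iff_ne_zero.2 hx : IsUnit (c x)))
  obtain ⟨L, hL⟩ := exists_ringHom_comp_algebraMap_eq_of_field (T := K ⊗[A] B) l
  refine ⟨L.comp
    (Algebra.TensorProduct.includeRight : B →ₐ[A] K ⊗[A] B).toRingHom, ?_⟩
  ext x
  have h1 : (Algebra.TensorProduct.includeRight : B →ₐ[A] K ⊗[A] B) (algebraMap A B x) =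
      algebraMap K (K ⊗[A] B) (algebraMap A K x) := by
    rw [AlgHom.commutes]
    rfl
  have h2 : L (algebraMap K (K ⊗[A] B) (algebraMap A K x)) = l (algebraMap A K x) :=
    congrArg (fun f => f (algebraMap A K x)) hL
  simp only [RingHom.comp_apply, AlgHom.toRingHom_eq_coe, RingHom.coe_coe, h1, h2]
  exact Ideal.ResidueField.lift_algebraMap _ c le_rfl _ x

/-- A complex point of the closure of the image of an irreducible closed subset of `Spec B`
lifts to a complex point of `B`, provided it avoids a suitable hypersurface. -/
lemma exists_notMem_forall_exists_ringHom {A B : Type*} [CommRing A] [CommRing B] [Algebra A B]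
    [Algebra.FinitePresentation A B] (q : Ideal B) [q.IsPrime] :
    ∃ G : A, G ∉ q.comap (algebraMap A B) ∧ ∀ c : A →+* ℂ,
      q.comap (algebraMap A B) ≤ RingHom.ker c → c G ≠ 0 →
        ∃ θ : B →+* ℂ, θ.comp (algebraMap A B) = c := by
  obtain ⟨S, hS⟩ := PrimeSpectrum.exists_constructibleSetData_iff.2
    (PrimeSpectrum.isConstructible_range_comap
      (RingHom.finitePresentation_algebraMap.2 ‹Algebra.FinitePresentation A B›))
  have hq : PrimeSpectrum.comap (algebraMap A B) ⟨q, ‹_›⟩ ∈ S.toSet := hS ▸ ⟨_, rfl⟩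
  simp only [PrimeSpectrum.ConstructibleSetData.toSet, Set.mem_iUnion] at hq
  obtain ⟨D, hD, hg, hf⟩ := hq
  have hf' : D.f ∉ q.comap (algebraMap A B) := by
    simpa [PrimeSpectrum.mem_zeroLocus] using hf
  refine ⟨D.f, hf', fun c hle hcf => exists_ringHom_comp_algebraMap_eq c ?_⟩
  rw [← hS]
  simp only [PrimeSpectrum.ConstructibleSetData.toSet, Set.mem_iUnion]
  refine ⟨D, hD, ?_, ?_⟩
  · rw [PrimeSpectrum.mem_zeroLocus] at hg ⊢
    exact hg.trans hle
  · simpa [PrimeSpectrum.mem_zeroLocus] using hcf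

/-- The rank of submodules is submodular. -/
lemma Submodule.finrank_add_finrank_le_add {M : Type*} [AddCommGroup M] [Module.Finite ℤ M]
    {p q s t : Submodule ℤ M} (hs : s ≤ p ⊔ q) (htp : t ≤ p) (htq : t ≤ q) :
    Module.finrank ℤ s + Module.finrank ℤ t ≤ Module.finrank ℤ p + Module.finrank ℤ q := by
  have h := Submodule.rank_sup_add_rank_inf_eq p q
  rw [← Module.finrank_eq_rank, ← Module.finrank_eq_rank, ← Module.finrank_eq_rank,
    ← Module.finrank_eq_rank] at h
  have h' : Module.finrank ℤ ↥(p ⊔ q) + Module.finrank ℤ ↥(p ⊓ q) =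
      Module.finrank ℤ p + Module.finrank ℤ q := by exact_mod_cast h
  have h1 := Submodule.finrank_mono hs
  have h2 := Submodule.finrank_mono (le_inf htp htq)
  omega

/-- **Rado's theorem** on independent transversals, for vectors in a lattice. -/
theorem exists_linearIndependent_transversal {M κ : Type*} [AddCommGroup M] [Module.Finite ℤ M]
    [Fintype κ] [DecidableEq κ] (V : κ → Finset M)
    (hV : ∀ I : Finset κ, I.card ≤
      Module.finrank ℤ ↥(⨆ j ∈ I, Submodule.span ℤ (V j : Set M))) :
    ∃ v : κ → M, (∀ j, v j ∈ V j) ∧ LinearIndependent ℤ v := by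
  classical
  induction hN : ∑ j, (V j).card using Nat.strong_induction_on generalizing V with
  | _ N ih =>
  subst hN
  have hne : ∀ j, (V j).Nonempty := by
    intro j
    by_contra hj
    rw [Finset.not_nonempty_iff_eq_empty] at hj
    have := hV {j}
    rw [Finset.iSup_singleton, hj, Finset.coe_empty, Submodule.span_empty, finrank_bot] at this
    simp at this
  by_cases hone : ∀ j, (V j).card ≤ 1
  · choose v hv using hne
    refine ⟨v, hv, linearIndependent_iff_card_le_finrank_span.2 ?_⟩
    refine (hV Finset.univ).trans (Submodule.finrank_mono ?_)
    refine iSup₂_le fun j _ => Submodule.span_mono fun x hx => ⟨j, ?_⟩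
    exact Finset.card_le_one.1 (hone j) _ (hv j) _ hx
  push Not at hone
  obtain ⟨j, hj⟩ := hone
  obtain ⟨x, hx, y, hy, hxy⟩ := Finset.one_lt_card.1 hj
  have key : ∀ z ∈ V j, (¬ ∃ v : κ → M, (∀ j, v j ∈ V j) ∧ LinearIndependent ℤ v) →
      ∃ B : Finset κ, j ∉ B ∧ Module.finrank ℤ ↥(Submodule.span ℤ ((V j).erase z : Set M) ⊔
        ⨆ k ∈ B, Submodule.span ℤ (V k : Set M)) ≤ B.card := by
    intro z hz hno
    by_contra! hB
    apply hno
    have hsub : ∀ k, Function.update V j ((V j).erase z) k ⊆ V k := by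
      intro k
      by_cases hk : k = j
      · subst hk; simpa using Finset.erase_subset _ _
      · simp [hk]
    have hcongr : ∀ B : Finset κ, j ∉ B →
        (⨆ k ∈ B, Submodule.span ℤ (Function.update V j ((V j).erase z) k : Set M)) =
        ⨆ k ∈ B, Submodule.span ℤ (V k : Set M) := by
      intro B hjB
      refine biSup_congr fun k hk => ?_
      rw [Function.update_of_ne (fun h : k = j => hjB (h ▸ hk))]
    have hV' : ∀ I : Finset κ, I.card ≤ Module.finrank ℤ
        ↥(⨆ k ∈ I, Submodule.span ℤ (Function.update V j ((V j).erase z) k : Set M)) := by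
      intro I
      by_cases hjI : j ∈ I
      · have := hB (I.erase j) (Finset.notMem_erase _ _)
        rw [← Finset.insert_erase hjI, Finset.card_insert_of_notMem (Finset.notMem_erase _ _),
          Finset.iSup_insert, hcongr _ (Finset.notMem_erase _ _), Function.update_self]
        exact this
      · rw [hcongr I hjI]
        exact hV I
    obtain ⟨v, hv, hli⟩ := ih _ (Finset.sum_lt_sum (fun k _ => Finset.card_le_card (hsub k))
      ⟨j, Finset.mem_univ j, by simpa using Finset.card_erase_lt_of_mem hz⟩)
      (Function.update V j ((V j).erase z)) hV' rfl
    exact ⟨v, fun k => hsub k (hv k), hli⟩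
  by_contra hno
  obtain ⟨B, hjB, hB⟩ := key x hx hno
  obtain ⟨B', hjB', hB'⟩ := key y hy hno
  have h1 := hV (insert j (B ∪ B'))
  have h2 := hV (B ∩ B')
  rw [Finset.card_insert_of_notMem (by simp [hjB, hjB'])] at h1
  have h3 := Finset.card_union_add_card_inter B B'
  have h4 := Submodule.finrank_add_finrank_le_add
    (p := Submodule.span ℤ ((V j).erase x : Set M) ⊔ ⨆ k ∈ B, Submodule.span ℤ (V k : Set M))
    (q := Submodule.span ℤ ((V j).erase y : Set M) ⊔ ⨆ k ∈ B', Submodule.span ℤ (V k : Set M))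
    (s := ⨆ k ∈ insert j (B ∪ B'), Submodule.span ℤ (V k : Set M))
    (t := ⨆ k ∈ B ∩ B', Submodule.span ℤ (V k : Set M)) ?_ ?_ ?_
  · omega
  · rw [Finset.iSup_insert]
    refine sup_le ?_ (iSup₂_le fun k hk => ?_)
    · rw [Submodule.span_le]
      intro z hz
      by_cases hzx : z = x
      · refine Submodule.mem_sup_right (Submodule.mem_sup_left (Submodule.subset_span ?_))
        simp only [Finset.coe_erase, Set.mem_sdiff, Set.mem_singleton_iff]
        exact ⟨hz, by rw [hzx]; exact hxy⟩
      · refine Submodule.mem_sup_left (Submodule.mem_sup_left (Submodule.subset_span ?_))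
        simp only [Finset.coe_erase, Set.mem_sdiff, Set.mem_singleton_iff]
        exact ⟨hz, hzx⟩
    · rcases Finset.mem_union.1 hk with h | h
      · exact (le_iSup₂_of_le (f := fun k _ => Submodule.span ℤ (V k : Set M)) k h le_rfl).trans
          (le_sup_right.trans le_sup_left)
      · exact (le_iSup₂_of_le (f := fun k _ => Submodule.span ℤ (V k : Set M)) k h le_rfl).trans
          (le_sup_right.trans le_sup_right)
  · exact (biSup_mono fun k hk => (Finset.mem_inter.1 hk).1).trans le_sup_right
  · exact (biSup_mono fun k hk => (Finset.mem_inter.1 hk).2).trans le_sup_right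

/-- A ring homomorphism from a ring of polynomials over the codomain is injective if it is so
after setting the parameter to zero. -/
lemma Polynomial.eval₂_X_injective_of_constantCoeff {R S : Type*} [CommRing R] [CommRing S]
    [IsDomain S] (ψ : R →+* Polynomial S)
    (hψ : Function.Injective fun r => (ψ r).coeff 0) (P : Polynomial R)
    (hP : P.eval₂ ψ Polynomial.X = 0) : P = 0 := by
  by_contra hne
  obtain ⟨Q, hQ⟩ : Polynomial.X ^ P.natTrailingDegree ∣ P :=
    Polynomial.X_pow_dvd_iff.2 fun d hd => Polynomial.coeff_eq_zero_of_lt_natTrailingDegree hd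
  have hQ0 : Q.coeff 0 ≠ 0 := by
    have h := Polynomial.trailingCoeff_nonzero_iff_nonzero.2 hne
    rw [Polynomial.trailingCoeff] at h
    have h2 : P.coeff P.natTrailingDegree = Q.coeff 0 := by
      have := Polynomial.coeff_X_pow_mul Q P.natTrailingDegree 0
      rwa [zero_add, ← hQ] at this
    rwa [h2] at h
  rw [hQ, Polynomial.eval₂_mul, Polynomial.eval₂_pow, Polynomial.eval₂_X] at hP
  have h1 := (mul_eq_zero.1 hP).resolve_left (pow_ne_zero _ Polynomial.X_ne_zero)
  apply hQ0
  apply hψ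
  have h2 := congrArg (fun q : Polynomial S => q.coeff 0) h1
  have h3 : (Polynomial.eval₂ ψ Polynomial.X Q).coeff 0 = (ψ (Q.coeff 0)).coeff 0 := by
    rw [Polynomial.coeff_zero_eq_eval_zero, ← Polynomial.coe_evalRingHom, Polynomial.hom_eval₂]
    simp [Polynomial.eval₂_at_zero, Polynomial.coeff_zero_eq_eval_zero]
  simp only [map_zero, Polynomial.coeff_zero] at h2 ⊢
  rw [← h3, h2]

/-- A homomorphism sending variables to monomials is injective if it is so on exponents. -/
lemma MvPolynomial.eval₂Hom_single_injective {σ G : Type*} [AddCommGroup G]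
    (e : σ → G) (f : σ → σ) (s : σ → ℤ) (hs : ∀ p, s p ≠ 0)
    (hinj : ∀ m m' : σ →₀ ℕ, (m.sum fun p k => k • e p) = (m'.sum fun p k => k • e p) →
      m.mapDomain f = m'.mapDomain f → m = m') :
    Function.Injective (MvPolynomial.eval₂Hom
      (Int.castRingHom (AddMonoidAlgebra (MvPolynomial σ ℤ) G))
      (fun p => AddMonoidAlgebra.single (e p) (MvPolynomial.C (s p) * MvPolynomial.X (f p)))) := by
  set Φ := MvPolynomial.eval₂Hom
      (Int.castRingHom (AddMonoidAlgebra (MvPolynomial σ ℤ) G))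
      (fun p => AddMonoidAlgebra.single (e p) (MvPolynomial.C (s p) * MvPolynomial.X (f p)))
    with hΦ
  have hC : ∀ c : ℤ, Φ (MvPolynomial.C c) = AddMonoidAlgebra.single 0 (MvPolynomial.C c) := by
    intro c
    rw [hΦ, MvPolynomial.eval₂Hom_C, eq_intCast, AddMonoidAlgebra.intCast_def,
      eq_intCast MvPolynomial.C c]
  have hmon : ∀ (m : σ →₀ ℕ) (c : ℤ), Φ (MvPolynomial.monomial m c) =
      AddMonoidAlgebra.single (m.sum fun p k => k • e p)
        (MvPolynomial.monomial (m.mapDomain f) (c * m.prod fun p k => s p ^ k)) := by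
    intro m
    induction m using Finsupp.induction_linear with
    | zero =>
      intro c
      simpa using hC c
    | add m m' h h' =>
      intro c
      have : MvPolynomial.monomial (m + m') c =
          MvPolynomial.monomial m c * MvPolynomial.monomial m' (1 : ℤ) := by
        rw [MvPolynomial.monomial_mul, mul_one]
      rw [this, map_mul, h, h', AddMonoidAlgebra.single_mul_single, MvPolynomial.monomial_mul,
        Finsupp.mapDomain_add, Finsupp.sum_add_index', Finsupp.prod_add_index']
      · congr 2; ring
      · simp
      · intros; ring
      · simp
      · intros; rw [add_smul]
    | single p k =>
      intro c
      have hX : Φ (MvPolynomial.X p) = AddMonoidAlgebra.single (e p)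
          (MvPolynomial.C (s p) * MvPolynomial.X (f p)) := MvPolynomial.eval₂_X _ _ _
      rw [← MvPolynomial.C_mul_X_pow_eq_monomial, map_mul, map_pow, hC, hX,
        AddMonoidAlgebra.single_pow, AddMonoidAlgebra.single_mul_single, Finsupp.mapDomain_single,
        ← MvPolynomial.C_mul_X_pow_eq_monomial, Finsupp.sum_single_index (zero_smul ℕ (e p)),
        Finsupp.prod_single_index (h := fun p k => s p ^ k) (pow_zero (s p)), zero_add, mul_pow, ← MvPolynomial.C_pow,
        ← mul_assoc, ← MvPolynomial.C_mul]
  rw [injective_iff_map_eq_zero]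
  intro P hP
  ext m
  rw [MvPolynomial.coeff_zero]
  by_contra hm
  have h1 : Φ P = ∑ m' ∈ P.support, AddMonoidAlgebra.single (m'.sum fun p k => k • e p)
      (MvPolynomial.monomial (m'.mapDomain f) (P.coeff m' * m'.prod fun p k => s p ^ k)) := by
    conv_lhs => rw [P.as_sum, map_sum]
    exact Finset.sum_congr rfl fun m' _ => hmon m' _
  have h2 := congrArg (fun g : AddMonoidAlgebra (MvPolynomial σ ℤ) G =>
    (g.coeff (m.sum fun p k => k • e p)).coeff (m.mapDomain f)) (h1.symm.trans hP)
  simp only [AddMonoidAlgebra.coeff_sum, AddMonoidAlgebra.coeff_single, Finsupp.finsetSum_apply,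
    MvPolynomial.coeff_sum, AddMonoidAlgebra.coeff_zero, Finsupp.coe_zero, Pi.zero_apply,
    MvPolynomial.coeff_zero] at h2
  classical
  rw [Finset.sum_eq_single_of_mem m (MvPolynomial.mem_support_iff.2 hm), Finsupp.single_eq_same, MvPolynomial.coeff_monomial,
    if_pos rfl] at h2
  · refine mul_ne_zero hm ?_ h2
    exact Finset.prod_ne_zero_iff.2 fun p _ => pow_ne_zero _ (hs p)
  · intro m' _ hne
    by_cases h3 : (m'.sum fun p k => k • e p) = m.sum fun p k => k • e p
    · rw [h3, Finsupp.single_eq_same, MvPolynomial.coeff_monomial,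
        if_neg fun h4 => hne (hinj _ _ h3 h4)]
    · rw [Finsupp.single_eq_of_ne (Ne.symm h3), MvPolynomial.coeff_zero]

/-- The homomorphism from a group algebra given by homomorphisms on coefficients and exponents. -/
def AddMonoidAlgebra.commLift {k G R : Type*} [CommRing k] [AddCommGroup G] [CommRing R]
    (f : k →+* R) (g : Multiplicative G →* R) : AddMonoidAlgebra k G →+* R :=
  AddMonoidAlgebra.liftNCRingHom f g fun x y => Commute.all (f x) (g y)

lemma AddMonoidAlgebra.commLift_single {k G R : Type*} [CommRing k] [AddCommGroup G] [CommRing R]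
    (f : k →+* R) (g : Multiplicative G →* R) (a : G) (b : k) :
    AddMonoidAlgebra.commLift f g (AddMonoidAlgebra.single a b) =
      f b * g (Multiplicative.ofAdd a) :=
  AddMonoidAlgebra.liftNC_single _ _ _ _

/-- The generic point of the incidence variety: solve the `j`-th equation with generic
coefficients, for `j ∈ I`, for the coefficient of the exponent `a₀ j`. -/
def genericSolution {κ G : Type*} [DecidableEq κ] [DecidableEq G] [AddCommGroup G]
    (A : κ → Finset G) (a₀ : κ → G) (I : Finset κ) :
    MvPolynomial (κ × G) ℤ →+* AddMonoidAlgebra (MvPolynomial (κ × G) ℤ) G :=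
  MvPolynomial.eval₂Hom (Int.castRingHom _) fun p =>
    if p.1 ∈ I ∧ p.2 = a₀ p.1 then
      -∑ a ∈ (A p.1).erase (a₀ p.1),
        AddMonoidAlgebra.single (a - a₀ p.1) (MvPolynomial.X (p.1, a) : MvPolynomial (κ × G) ℤ)
    else AddMonoidAlgebra.single 0 (MvPolynomial.X p)

section genericSolution

variable {κ G : Type*} [DecidableEq κ] [DecidableEq G] [AddCommGroup G]

lemma genericSolution_X_of_mem (A : κ → Finset G) (a₀ : κ → G) {I : Finset κ} {j : κ}
    (hj : j ∈ I) :
    genericSolution A a₀ I (MvPolynomial.X (j, a₀ j)) = -∑ a ∈ (A j).erase (a₀ j),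
      AddMonoidAlgebra.single (a - a₀ j)
        (MvPolynomial.X (j, a) : MvPolynomial (κ × G) ℤ) := by
  simp [genericSolution, hj]

lemma genericSolution_X_of_not (A : κ → Finset G) (a₀ : κ → G) {I : Finset κ} {p : κ × G}
    (hp : ¬ (p.1 ∈ I ∧ p.2 = a₀ p.1)) :
    genericSolution A a₀ I (MvPolynomial.X p) =
      AddMonoidAlgebra.single 0 (MvPolynomial.X p) := by
  simp only [genericSolution, MvPolynomial.eval₂Hom_X', if_neg hp]

/-- Exponents are determined by the monomials attached to independent edges. -/
lemma exponent_injective_of_linearIndependent (a₀ a₁ : κ → G) (I : Finset κ)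
    (hli : LinearIndependent ℤ fun j : I => a₁ j - a₀ j) (m m' : κ × G →₀ ℕ)
    (h1 : (m.sum fun p k => k • (if p.1 ∈ I ∧ p.2 = a₀ p.1 then a₁ p.1 - a₀ p.1 else 0)) =
      m'.sum fun p k => k • (if p.1 ∈ I ∧ p.2 = a₀ p.1 then a₁ p.1 - a₀ p.1 else 0))
    (h2 : m.mapDomain (fun p => if p.1 ∈ I ∧ p.2 = a₀ p.1 then (p.1, a₁ p.1) else p) =
      m'.mapDomain (fun p => if p.1 ∈ I ∧ p.2 = a₀ p.1 then (p.1, a₁ p.1) else p)) :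
    m = m' := by
  classical
  have hsum : ∀ m : κ × G →₀ ℕ,
      (m.sum fun p k => k • (if p.1 ∈ I ∧ p.2 = a₀ p.1 then a₁ p.1 - a₀ p.1 else 0)) =
        ∑ j : I, (m (j, a₀ j) : ℤ) • (a₁ j - a₀ j) := by
    intro m
    induction m using Finsupp.induction_linear with
    | zero => simp
    | add m m' h h' =>
      rw [Finsupp.sum_add_index' (by simp) (by intros; rw [add_smul]), h, h',
        ← Finset.sum_add_distrib]
      refine Finset.sum_congr rfl fun j _ => ?_
      rw [← add_smul]
      simp
    | single p k =>
      rw [Finsupp.sum_single_index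
        (h := fun (p : κ × G) (k : ℕ) => k • (if p.1 ∈ I ∧ p.2 = a₀ p.1 then a₁ p.1 - a₀ p.1 else 0))
        (zero_smul ℕ _)]
      by_cases hp : p.1 ∈ I ∧ p.2 = a₀ p.1
      · rw [if_pos hp, Finset.sum_eq_single_of_mem (⟨p.1, hp.1⟩ : I) (Finset.mem_univ _)]
        · have : p = (p.1, a₀ p.1) := Prod.ext rfl hp.2
          rw [← this, Finsupp.single_eq_same, natCast_zsmul]
        · intro j _ hj
          rw [Finsupp.single_eq_of_ne, Nat.cast_zero, zero_smul]
          rintro rfl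
          exact hj rfl
      · rw [if_neg hp, smul_zero]
        symm
        refine Finset.sum_eq_zero fun j _ => ?_
        rw [Finsupp.single_eq_of_ne, Nat.cast_zero, zero_smul]
        rintro rfl
        exact hp ⟨j.2, rfl⟩
  have hB : ∀ p : κ × G, p.1 ∈ I ∧ p.2 = a₀ p.1 → m p = m' p := by
    rintro ⟨j, a⟩ ⟨hj, ha⟩
    obtain rfl : a = a₀ j := ha
    rw [hsum, hsum, ← sub_eq_zero, ← Finset.sum_sub_distrib] at h1
    simp_rw [← sub_smul] at h1
    have := Fintype.linearIndependent_iff.1 hli _ h1 ⟨j, hj⟩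
    exact_mod_cast sub_eq_zero.1 this
  have hm : ∀ m : κ × G →₀ ℕ,
      m.mapDomain (fun p => if p.1 ∈ I ∧ p.2 = a₀ p.1 then (p.1, a₁ p.1) else p) =
      (m.filter fun p => p.1 ∈ I ∧ p.2 = a₀ p.1).mapDomain
        (fun p => if p.1 ∈ I ∧ p.2 = a₀ p.1 then (p.1, a₁ p.1) else p) +
      m.filter fun p => ¬ (p.1 ∈ I ∧ p.2 = a₀ p.1) := by
    intro m
    conv_lhs => rw [← Finsupp.filter_add_filter_not m
      (fun p => p.1 ∈ I ∧ p.2 = a₀ p.1), Finsupp.mapDomain_add]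
    congr 1
    conv_rhs => rw [← Finsupp.mapDomain_id (v := m.filter _)]
    refine Finsupp.mapDomain_congr fun p hp => ?_
    rw [Finsupp.support_filter, Finset.mem_filter] at hp
    rw [if_neg hp.2, id]
  have hf : (m.filter fun p => p.1 ∈ I ∧ p.2 = a₀ p.1) =
      m'.filter fun p => p.1 ∈ I ∧ p.2 = a₀ p.1 := by
    ext p
    by_cases hp : p.1 ∈ I ∧ p.2 = a₀ p.1
    · rw [Finsupp.filter_apply_pos (fun p : κ × G => p.1 ∈ I ∧ p.2 = a₀ p.1) _ hp,
        Finsupp.filter_apply_pos (fun p : κ × G => p.1 ∈ I ∧ p.2 = a₀ p.1) _ hp, hB p hp]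
    · rw [Finsupp.filter_apply_neg (fun p : κ × G => p.1 ∈ I ∧ p.2 = a₀ p.1) _ hp,
        Finsupp.filter_apply_neg (fun p : κ × G => p.1 ∈ I ∧ p.2 = a₀ p.1) _ hp]
  rw [hm, hm m', hf, add_left_cancel_iff] at h2
  rw [← Finsupp.filter_add_filter_not m (fun p => p.1 ∈ I ∧ p.2 = a₀ p.1), hf, h2,
    Finsupp.filter_add_filter_not]

/-- If the supports have an independent transversal, the generic coefficients of the family
indexed by `I` satisfy no polynomial relation when they have a common root. -/
lemma genericSolution_injective [IsDomain (AddMonoidAlgebra (MvPolynomial (κ × G) ℤ) G)]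
    (A : κ → Finset G) (a₀ a₁ : κ → G) (I : Finset κ) (ha₁ : ∀ j ∈ I, a₁ j ∈ A j)
    (hli : LinearIndependent ℤ fun j : I => a₁ j - a₀ j) :
    Function.Injective (genericSolution A a₀ I) := by
  set S := AddMonoidAlgebra (MvPolynomial (κ × G) ℤ) G with hS
  have hne : ∀ j ∈ I, a₁ j ≠ a₀ j := fun j hj h =>
    hli.ne_zero ⟨j, hj⟩ (sub_eq_zero.2 h)
  let D : κ × G → Prop := fun p => p.1 ∈ I ∧ p.2 = a₀ p.1
  let T : κ × G → Prop := fun p => p.1 ∈ I ∧ p.2 ≠ a₀ p.1 ∧ p.2 ≠ a₁ p.1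
  let : DecidablePred D := fun p => inferInstanceAs (Decidable (p.1 ∈ I ∧ p.2 = a₀ p.1))
  let : DecidablePred T := fun p =>
    inferInstanceAs (Decidable (p.1 ∈ I ∧ p.2 ≠ a₀ p.1 ∧ p.2 ≠ a₁ p.1))
  let α : S →+* Polynomial S := AddMonoidAlgebra.commLift (R := Polynomial S)
    (MvPolynomial.eval₂Hom (Int.castRingHom (Polynomial S)) fun p =>
      (if T p then Polynomial.X else 1) *
        Polynomial.C (AddMonoidAlgebra.single 0 (MvPolynomial.X p)))
    ((Polynomial.C : S →+* Polynomial S).toMonoidHom.comp (AddMonoidAlgebra.of _ G))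
  have hα : ∀ g p, α (AddMonoidAlgebra.single g (MvPolynomial.X p)) =
      (if T p then Polynomial.X else 1) *
        Polynomial.C (AddMonoidAlgebra.single g (MvPolynomial.X p)) := by
    intro g p
    simp only [α]
    rw [AddMonoidAlgebra.commLift_single, MvPolynomial.eval₂Hom_X', mul_assoc]
    congr 1
    change Polynomial.C _ * Polynomial.C (AddMonoidAlgebra.single g 1) = _
    rw [← Polynomial.C_mul, AddMonoidAlgebra.single_mul_single, zero_add, mul_one]
  let β : MvPolynomial (κ × G) ℤ →+* Polynomial (MvPolynomial (κ × G) ℤ) :=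
    MvPolynomial.eval₂Hom (Int.castRingHom _) fun p =>
      (if T p then Polynomial.X else 1) * Polynomial.C (MvPolynomial.X p)
  have hβ : Function.Injective β := by
    have : (Polynomial.evalRingHom 1).comp β = RingHom.id _ := by
      refine MvPolynomial.ringHom_ext (fun r => by simp [β]) fun p => ?_
      simp only [β, RingHom.comp_apply, MvPolynomial.eval₂Hom_X', map_mul, RingHom.id_apply]
      split_ifs <;> simp
    exact Function.LeftInverse.injective (g := Polynomial.evalRingHom 1) fun F =>
      congrArg (fun f => f F) this
  let ψ : MvPolynomial (κ × G) ℤ →+* Polynomial S :=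
    MvPolynomial.eval₂Hom (Int.castRingHom (Polynomial S)) fun p =>
      if D p then
        -(Polynomial.C (AddMonoidAlgebra.single (a₁ p.1 - a₀ p.1) (MvPolynomial.X (p.1, a₁ p.1))) +
          Polynomial.X * ∑ a ∈ ((A p.1).erase (a₀ p.1)).erase (a₁ p.1),
            Polynomial.C (AddMonoidAlgebra.single (a - a₀ p.1)
              (MvPolynomial.X (p.1, a) : MvPolynomial (κ × G) ℤ)))
      else Polynomial.C (AddMonoidAlgebra.single 0 (MvPolynomial.X p))
  have hψ : Function.Injective fun F => (ψ F).coeff 0 := by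
    have h1 := MvPolynomial.eval₂Hom_single_injective (σ := κ × G)
      (fun p => if p.1 ∈ I ∧ p.2 = a₀ p.1 then a₁ p.1 - a₀ p.1 else 0)
      (fun p => if p.1 ∈ I ∧ p.2 = a₀ p.1 then (p.1, a₁ p.1) else p)
      (fun p => if p.1 ∈ I ∧ p.2 = a₀ p.1 then -1 else 1)
      (fun p => by split_ifs <;> simp)
      (exponent_injective_of_linearIndependent a₀ a₁ I hli)
    convert h1 using 1
    ext1 F
    rw [Polynomial.coeff_zero_eq_eval_zero]
    refine DFunLike.congr_fun (f := (Polynomial.evalRingHom 0).comp ψ)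
      (MvPolynomial.ringHom_ext (fun r => ?_) fun p => ?_) F
    · simp [ψ]
    · simp only [ψ, RingHom.comp_apply, MvPolynomial.eval₂Hom_X', D]
      split_ifs with hp
      · simp [AddMonoidAlgebra.single_neg]
      · simp
  have hcomp : α.comp (genericSolution A a₀ I) =
      (Polynomial.eval₂RingHom (S := Polynomial S) ψ Polynomial.X).comp β := by
    refine MvPolynomial.ringHom_ext (fun r => by simp) fun p => ?_
    simp only [β, RingHom.comp_apply, MvPolynomial.eval₂Hom_X', map_mul,
      Polynomial.coe_eval₂RingHom, Polynomial.eval₂_C]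
    by_cases hp : D p
    · have hT : ¬ T p := fun h => h.2.1 hp.2
      obtain ⟨j, a⟩ := p
      obtain ⟨hj, ha⟩ := hp
      obtain rfl : a = a₀ j := ha
      have hD : D (j, a₀ j) := ⟨hj, rfl⟩
      rw [genericSolution_X_of_mem _ _ hj, if_neg hT, Polynomial.eval₂_one, one_mul]
      simp only [ψ, MvPolynomial.eval₂Hom_X', if_pos hD]
      rw [map_neg, map_sum, ← Finset.add_sum_erase _ _
        (Finset.mem_erase.2 ⟨hne j hj, ha₁ j hj⟩)]
      congr 2
      · rw [hα, if_neg (fun h => h.2.2 rfl), one_mul]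
      · rw [Finset.mul_sum]
        refine Finset.sum_congr rfl fun a ha => ?_
        simp only [Finset.mem_erase] at ha
        rw [hα, if_pos ⟨hj, ha.2.1, ha.1⟩]
    · rw [genericSolution_X_of_not _ _ hp, hα]
      simp only [ψ, MvPolynomial.eval₂Hom_X', if_neg hp]
      split_ifs <;> simp
  rw [injective_iff_map_eq_zero]
  intro F hF
  have h1 : α (genericSolution A a₀ I F) = (β F).eval₂ ψ Polynomial.X :=
    congrArg (fun f => f F) hcomp
  rw [hF, map_zero] at h1
  exact (map_eq_zero_iff β hβ).1
    (Polynomial.eval₂_X_injective_of_constantCoeff ψ hψ _ h1.symm)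

end genericSolution

/-- Elements algebraic over a finite set, and more numerous than it, are algebraically
dependent. -/
lemma exists_ne_zero_aeval_eq_zero_of_isAlgebraic {ι S : Type*} [Finite ι] [CommRing S]
    [IsDomain S] [FaithfulSMul ℤ S] (x : ι → S) (W : Finset S)
    (hx : ∀ i, IsAlgebraic (Algebra.adjoin ℤ (W : Set S)) (x i)) (hW : W.card < Nat.card ι) :
    ∃ F : MvPolynomial ι ℤ, F ≠ 0 ∧ MvPolynomial.aeval x F = 0 := by
  by_contra! hno
  have hind : AlgebraicIndependent ℤ x :=
    algebraicIndependent_iff.2 fun F hF => by_contra fun h => hno F h hF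
  have hI : (AlgebraicIndependent.matroid ℤ S).Indep (Set.range x) :=
    AlgebraicIndependent.matroid_indep_iff.2 hind.to_subtype_range
  have hsub : Set.range x ⊆ (AlgebraicIndependent.matroid ℤ S).closure (W : Set S) := by
    rw [AlgebraicIndependent.matroid_closure_eq]
    rintro _ ⟨i, rfl⟩
    exact (Subalgebra.mem_algebraicClosure _ _).2 (hx i)
  have h := (hI.encard_le_eRk_of_subset hsub).trans
    ((Matroid.eRk_closure_eq _ _).le.trans (Matroid.eRk_le_encard _ _))
  rw [Set.encard_coe_eq_coe_finsetCard, ← Set.image_univ,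
    hind.injective.encard_image, Set.encard_univ, ENat.card_eq_coe_natCard] at h
  exact absurd (Nat.cast_le.1 h) (not_le.2 hW)

lemma isAlgebraic_of_algebraMap_mul_eq_one {R S : Type*} [CommRing R] [CommRing S] [Nontrivial R]
    [Algebra R S] {w : R} {u : S} (h : algebraMap R S w * u = 1) : IsAlgebraic R u := by
  refine ⟨Polynomial.C w * Polynomial.X - 1, fun h0 => ?_, by simp [h]⟩
  simpa using congrArg (Polynomial.eval 0) h0

section genericSolution

variable {κ G : Type*} [DecidableEq κ] [DecidableEq G] [AddCommGroup G]

/-- If the supports indexed by `J` span a lattice of rank less than the size of `J`, then the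
coefficients in these groups satisfy a polynomial relation on the incidence variety. -/
lemma exists_ne_zero_genericSolution_eq_zero
    [IsDomain (AddMonoidAlgebra (MvPolynomial (κ × G) ℤ) G)]
    (A : κ → Finset G) (a₀ : κ → G) (ha₀ : ∀ j, a₀ j ∈ A j) (I J : Finset κ) (hJI : J ⊆ I)
    {ι : Type*} [Fintype ι] (b : ι → G) (hb : Fintype.card ι < J.card)
    (hspan : ∀ j ∈ J, ∀ a ∈ A j, a - a₀ j ∈ Submodule.span ℤ (Set.range b)) :
    ∃ F : MvPolynomial (κ × G) ℤ, F ≠ 0 ∧ (∀ p ∈ F.vars, p.1 ∈ J) ∧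
      genericSolution A a₀ I F = 0 := by
  classical
  set S := AddMonoidAlgebra (MvPolynomial (κ × G) ℤ) G with hS
  let Q : Finset (κ × G) := J.biUnion fun j => (A j).image fun a => (j, a)
  have hQ : ∀ p, p ∈ Q ↔ p.1 ∈ J ∧ p.2 ∈ A p.1 := by
    rintro ⟨j, a⟩
    simp only [Q, Finset.mem_biUnion, Finset.mem_image, Prod.mk.injEq]
    constructor
    · rintro ⟨j, hj, a, ha, rfl, rfl⟩
      exact ⟨hj, ha⟩
    · rintro ⟨hj, ha⟩
      exact ⟨j, hj, a, ha, rfl, rfl⟩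
  let W : Finset S := ((Q.filter fun p => p.2 ≠ a₀ p.1).image fun p =>
      AddMonoidAlgebra.single 0 (MvPolynomial.X p)) ∪
    Finset.univ.image fun k => AddMonoidAlgebra.single (b k) 1
  have hWcard : W.card < Nat.card Q := by
    have h1 : (Q.filter fun p => ¬ p.2 ≠ a₀ p.1) = J.image fun j => (j, a₀ j) := by
      ext ⟨j, a⟩
      simp only [Finset.mem_filter, hQ, Finset.mem_image, Prod.mk.injEq, ne_eq, not_not]
      constructor
      · rintro ⟨⟨hj, -⟩, rfl⟩
        exact ⟨j, hj, rfl, rfl⟩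
      · rintro ⟨j, hj, rfl, rfl⟩
        exact ⟨⟨hj, ha₀ j⟩, rfl⟩
    have h2 := Finset.card_filter_add_card_filter_not (s := Q) (fun p => p.2 ≠ a₀ p.1)
    rw [h1, Finset.card_image_of_injective _ fun j k h => congrArg Prod.fst h] at h2
    have h3 : W.card ≤ _ := Finset.card_union_le _ _
    have h4 : (Finset.image (fun p => (AddMonoidAlgebra.single 0 (MvPolynomial.X p) : S))
      (Q.filter fun p => p.2 ≠ a₀ p.1)).card ≤ _ := Finset.card_image_le
    have h5 : (Finset.image (fun k => (AddMonoidAlgebra.single (b k) 1 : S))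
      Finset.univ).card ≤ _ := Finset.card_image_le
    rw [Nat.card_eq_fintype_card, Fintype.card_coe]
    rw [Finset.card_univ] at h5
    omega
  let C := Subalgebra.algebraicClosure (Algebra.adjoin ℤ (W : Set S)) S
  have hWC : ∀ w ∈ W, w ∈ C := fun w hw => (Subalgebra.mem_algebraicClosure _ _).2
    (isAlgebraic_algebraMap (⟨w, Algebra.subset_adjoin hw⟩ : Algebra.adjoin ℤ (W : Set S)))
  have hbC : ∀ k, (AddMonoidAlgebra.single (b k) 1 : S) ∈ C := fun k =>
    hWC _ (Finset.mem_union_right _ (Finset.mem_image_of_mem _ (Finset.mem_univ k)))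
  have hbC' : ∀ k, (AddMonoidAlgebra.single (-b k) 1 : S) ∈ C := by
    intro k
    let w : Algebra.adjoin ℤ (W : Set S) := ⟨AddMonoidAlgebra.single (b k) 1,
      Algebra.subset_adjoin (Finset.mem_coe.2 (Finset.mem_union_right _
        (Finset.mem_image_of_mem _ (Finset.mem_univ k))))⟩
    refine (Subalgebra.mem_algebraicClosure _ _).2
      (isAlgebraic_of_algebraMap_mul_eq_one (w := w) ?_)
    change AddMonoidAlgebra.single (b k) 1 * AddMonoidAlgebra.single (-b k) 1 = _
    rw [AddMonoidAlgebra.single_mul_single, add_neg_cancel, mul_one]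
    exact AddMonoidAlgebra.one_def.symm
  have hspanC : ∀ v ∈ Submodule.span ℤ (Set.range b),
      (AddMonoidAlgebra.single v 1 : S) ∈ C := by
    intro v hv
    rw [← Submodule.mem_toAddSubgroup, Submodule.span_int_eq_addSubgroupClosure,
      ← AddSubgroup.mem_toAddSubmonoid, AddSubgroup.closure_toAddSubmonoid] at hv
    induction hv using AddSubmonoid.closure_induction with
    | mem v hv =>
      rcases hv with ⟨k, rfl⟩ | ⟨k, hk⟩
      · exact hbC k
      · rw [← neg_neg v, ← hk]
        exact hbC' k
    | zero => exact C.one_mem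
    | add v w _ _ hv hw =>
      have := C.mul_mem hv hw
      rwa [AddMonoidAlgebra.single_mul_single, mul_one] at this
  have hXC : ∀ p ∈ Q, p.2 ≠ a₀ p.1 →
      (AddMonoidAlgebra.single 0 (MvPolynomial.X p) : S) ∈ C := fun p hp hne =>
    hWC _ (Finset.mem_union_left _ (Finset.mem_image_of_mem _ (Finset.mem_filter.2 ⟨hp, hne⟩)))
  have halg : ∀ p : Q, IsAlgebraic (Algebra.adjoin ℤ (W : Set S))
      (genericSolution A a₀ I (MvPolynomial.X p)) := by
    intro p
    obtain ⟨⟨j, a⟩, hp⟩ := p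
    by_cases ha : a = a₀ j
    · subst ha
      have hj := ((hQ _).1 hp).1
      simp only
      rw [genericSolution_X_of_mem _ _ (hJI hj)]
      refine IsAlgebraic.neg ((Subalgebra.mem_algebraicClosure _ _).1 (C.sum_mem fun a ha => ?_))
      rw [Finset.mem_erase] at ha
      have := C.mul_mem (hspanC _ (hspan j hj a ha.2))
        (hXC (j, a) ((hQ _).2 ⟨hj, ha.2⟩) ha.1)
      rwa [AddMonoidAlgebra.single_mul_single, add_zero, one_mul] at this
    · simp only
      rw [genericSolution_X_of_not _ _ fun h => ha h.2]
      exact (Subalgebra.mem_algebraicClosure _ _).1 (hXC _ hp ha)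
  obtain ⟨F, hF0, hF⟩ := exists_ne_zero_aeval_eq_zero_of_isAlgebraic
    (fun p : Q => genericSolution A a₀ I (MvPolynomial.X p)) W halg hWcard
  refine ⟨MvPolynomial.rename Subtype.val F, ?_, ?_, ?_⟩
  · rwa [Ne, MvPolynomial.rename_eq_zero_iff_of_injective _ Subtype.val_injective]
  · intro p hp
    have := MvPolynomial.vars_rename _ _ hp
    obtain ⟨q, -, rfl⟩ := Finset.mem_image.1 this
    exact ((hQ _).1 q.2).1
  · rw [← hF]
    have : (genericSolution A a₀ I).comp
        (MvPolynomial.rename (R := ℤ) (Subtype.val : Q → κ × G)).toRingHom =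
        (MvPolynomial.aeval (R := ℤ)
          fun p : Q => genericSolution A a₀ I (MvPolynomial.X p)).toRingHom :=
      MvPolynomial.ringHom_ext (fun r => by simp) fun p => by simp
    exact congrArg (fun f => f F) this

end genericSolution

section Points

/-- Evaluation of characters at a point of the torus. -/
def chEvalHom (ξ : Fin n → ℂˣ) : Multiplicative (Fin n → ℤ) →* ℂ where
  toFun a := chEval ξ a.toAdd
  map_one' := by simp [chEval]
  map_mul' a b := by simp [chEval, zpow_add, Finset.prod_mul_distrib]

lemma sum_genericSolution_mul_single_eq_zero {κ G : Type*} [DecidableEq κ] [DecidableEq G]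
    [AddCommGroup G] (A : κ → Finset G) (a₀ : κ → G) {I : Finset κ} {j : κ} (hj : j ∈ I)
    (ha₀ : a₀ j ∈ A j) :
    ∑ a ∈ A j, genericSolution A a₀ I (MvPolynomial.X (j, a)) *
      AddMonoidAlgebra.single a (1 : MvPolynomial (κ × G) ℤ) = 0 := by
  have h : genericSolution A a₀ I (MvPolynomial.X (j, a₀ j)) + ∑ a ∈ (A j).erase (a₀ j),
      AddMonoidAlgebra.single (a - a₀ j) (MvPolynomial.X (j, a) : MvPolynomial (κ × G) ℤ) = 0 := by
    rw [genericSolution_X_of_mem _ _ hj, neg_add_cancel]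
  have h' := congrArg (· * AddMonoidAlgebra.single (a₀ j) (1 : MvPolynomial (κ × G) ℤ)) h
  simp only [add_mul, zero_mul, Finset.sum_mul] at h'
  rw [← Finset.add_sum_erase _ _ ha₀, ← h']
  congr 1
  refine Finset.sum_congr rfl fun a ha => ?_
  rw [genericSolution_X_of_not _ _ fun h => Finset.ne_of_mem_erase ha h.2,
    AddMonoidAlgebra.single_mul_single, AddMonoidAlgebra.single_mul_single, sub_add_cancel,
    zero_add]

lemma evalCoeff_eq_zero_of_genericSolution_eq_zero {A : Fin (n + 1) → Finset (Fin n → ℤ)}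
    {a₀ : Fin (n + 1) → Fin n → ℤ} (ha₀ : ∀ j, a₀ j ∈ A j)
    {F : MvPolynomial (Fin (n + 1) × (Fin n → ℤ)) ℤ}
    (hF : genericSolution A a₀ Finset.univ F = 0) {c : Fin (n + 1) → (Fin n → ℤ) → ℂ}
    (hc : HasRoot A c) : evalCoeff F c = 0 := by
  obtain ⟨ξ, hξ⟩ := hc
  let ev := AddMonoidAlgebra.commLift
    (MvPolynomial.aeval (R := ℤ) fun p : Fin (n + 1) × (Fin n → ℤ) => c p.1 p.2).toRingHom
    (chEvalHom ξ)
  have hev : ∀ a p, ev (AddMonoidAlgebra.single a (MvPolynomial.X p)) =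
      c p.1 p.2 * chEval ξ a := by
    intro a p
    simp only [ev]
    rw [AddMonoidAlgebra.commLift_single]
    simp [chEvalHom]
  have hadd : ∀ a b, chEval ξ (a + b) = chEval ξ a * chEval ξ b := fun a b =>
    (chEvalHom ξ).map_mul (Multiplicative.ofAdd a) (Multiplicative.ofAdd b)
  have hzero : chEval ξ 0 = 1 := (chEvalHom ξ).map_one
  have hne : ∀ a, chEval ξ a ≠ 0 := fun a h => by
    have := hadd a (-a)
    rw [add_neg_cancel, hzero, h, zero_mul] at this
    exact one_ne_zero this
  have hcomp : ev.comp (genericSolution A a₀ Finset.univ) =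
      (MvPolynomial.aeval (R := ℤ) fun p : Fin (n + 1) × (Fin n → ℤ) => c p.1 p.2).toRingHom := by
    refine MvPolynomial.ringHom_ext (fun r => by simp) fun p => ?_
    by_cases hp : p.2 = a₀ p.1
    · obtain ⟨j, a⟩ := p
      obtain rfl : a = a₀ j := hp
      rw [RingHom.comp_apply, genericSolution_X_of_mem _ _ (Finset.mem_univ j), map_neg, map_sum]
      simp_rw [hev]
      have h := hξ j
      rw [← Finset.add_sum_erase _ _ (ha₀ j)] at h
      apply mul_right_cancel₀ (hne (a₀ j))
      rw [neg_mul, Finset.sum_mul]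
      simp_rw [mul_assoc, ← hadd, sub_add_cancel]
      rw [neg_eq_iff_add_eq_zero, add_comm]
      simpa using h
    · rw [RingHom.comp_apply, genericSolution_X_of_not _ _ fun h => hp h.2, hev, hzero, mul_one]
      simp
  have h : ev (genericSolution A a₀ Finset.univ F) = evalCoeff F c := congrArg (fun f => f F) hcomp
  rw [← h, hF, map_zero]

open TensorProduct in
/-- The projection of the incidence variety contains a nonempty open subset of its closure. -/
lemma exists_genericSolution_ne_zero_forall_hasRoot {A : Fin (n + 1) → Finset (Fin n → ℤ)}
    {a₀ : Fin (n + 1) → Fin n → ℤ} (ha₀ : ∀ j, a₀ j ∈ A j) :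
    ∃ H : MvPolynomial (Fin (n + 1) × (Fin n → ℤ)) ℤ,
      genericSolution A a₀ Finset.univ H ≠ 0 ∧
      ∀ c, (∀ F, genericSolution A a₀ Finset.univ F = 0 → evalCoeff F c = 0) →
        evalCoeff H c ≠ 0 → HasRoot A c := by
  classical
  set P := MvPolynomial (Fin (n + 1) × (Fin n → ℤ)) ℤ with hP
  let L := AddMonoidAlgebra ℤ (Fin n → ℤ)
  let S := AddMonoidAlgebra P (Fin n → ℤ)
  have hL : Algebra.FinitePresentation ℤ L := Algebra.FinitePresentation.of_finiteType.1
    inferInstance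
  let eqn : Fin (n + 1) → P ⊗[ℤ] L := fun j => ∑ a ∈ A j,
    (MvPolynomial.X (j, a) : P) ⊗ₜ[ℤ] (AddMonoidAlgebra.single a 1 : L)
  let 𝔞 : Ideal (P ⊗[ℤ] L) := Ideal.span (Finset.univ.image eqn : Finset (P ⊗[ℤ] L))
  have hfp : Algebra.FinitePresentation P ((P ⊗[ℤ] L) ⧸ 𝔞) :=
    Algebra.FinitePresentation.quotient ⟨_, rfl⟩
  let g : L →+* S := AddMonoidAlgebra.commLift (R := S) (Int.castRingHom S)
    (AddMonoidAlgebra.of P (Fin n → ℤ))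
  have hg : ∀ a, g (AddMonoidAlgebra.single a 1) = AddMonoidAlgebra.single a 1 := by
    intro a
    simp only [g]
    rw [AddMonoidAlgebra.commLift_single, map_one, one_mul]
    rfl
  let Φ : P ⊗[ℤ] L →ₐ[ℤ] S := Algebra.TensorProduct.productMap
    (genericSolution A a₀ Finset.univ).toIntAlgHom g.toIntAlgHom
  have hΦ : ∀ x y, Φ (x ⊗ₜ y) = genericSolution A a₀ Finset.univ x * g y := fun x y =>
    Algebra.TensorProduct.productMap_apply_tmul _ _ _ _
  have hΦ0 : ∀ x ∈ 𝔞, (Φ : P ⊗[ℤ] L →+* S) x = 0 := by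
    intro x hx
    have : 𝔞 ≤ RingHom.ker (Φ : P ⊗[ℤ] L →+* S) := by
      refine Ideal.span_le.2 fun y hy => ?_
      obtain ⟨j, -, rfl⟩ := Finset.mem_image.1 (Finset.mem_coe.1 hy)
      change Φ _ = 0
      rw [map_sum]
      simp_rw [hΦ, hg]
      exact sum_genericSolution_mul_single_eq_zero A a₀ (Finset.mem_univ j) (ha₀ j)
    exact this hx
  let q := RingHom.ker (Ideal.Quotient.lift 𝔞 (Φ : P ⊗[ℤ] L →+* S) hΦ0)
  have hq : ∀ F : P, F ∈ q.comap (algebraMap P ((P ⊗[ℤ] L) ⧸ 𝔞)) ↔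
      genericSolution A a₀ Finset.univ F = 0 := by
    intro F
    rw [Ideal.mem_comap, RingHom.mem_ker]
    change Φ (F ⊗ₜ 1) = 0 ↔ _
    rw [hΦ, map_one, mul_one]
  have : q.IsPrime := RingHom.ker_isPrime _
  obtain ⟨H, hH, h⟩ := exists_notMem_forall_exists_ringHom (A := P)
    (B := (P ⊗[ℤ] L) ⧸ 𝔞) q
  refine ⟨H, fun h0 => hH ((hq H).2 h0), fun c hc hcH => ?_⟩
  obtain ⟨θ, hθ⟩ := h (MvPolynomial.aeval (R := ℤ) fun p : Fin (n + 1) × (Fin n → ℤ) =>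
    c p.1 p.2).toRingHom (fun F hF => hc F ((hq F).1 hF)) hcH
  let θ' : P ⊗[ℤ] L →+* ℂ := θ.comp (Ideal.Quotient.mk 𝔞)
  let χ : Multiplicative (Fin n → ℤ) →* ℂ := ((θ'.comp
    (Algebra.TensorProduct.includeRight : L →ₐ[ℤ] P ⊗[ℤ] L).toRingHom) : L →* ℂ).comp
      (AddMonoidAlgebra.of ℤ (Fin n → ℤ))
  let χ' : Multiplicative (Fin n → ℤ) →* ℂˣ := χ.toHomUnits
  refine ⟨fun k => χ' (Multiplicative.ofAdd (Pi.single k 1)), fun j => ?_⟩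
  have hχ : ∀ a, chEval (fun k => χ' (Multiplicative.ofAdd (Pi.single k 1))) a =
      χ (Multiplicative.ofAdd a) := by
    intro a
    have h1 : Multiplicative.ofAdd a =
        ∏ k, Multiplicative.ofAdd (Pi.single k (1 : ℤ) : Fin n → ℤ) ^ a k := by
      simp_rw [← ofAdd_zsmul]
      rw [← ofAdd_sum]
      congr 1
      ext k
      simp [Finset.sum_apply, Pi.single_apply]
    have h2 : χ (Multiplicative.ofAdd a) = (χ' (Multiplicative.ofAdd a) : ℂ) := rfl
    rw [h2, h1, map_prod, Units.coe_prod, chEval]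
    simp_rw [map_zpow]
  simp_rw [hχ]
  have h1 : θ' (eqn j) = 0 := by
    rw [RingHom.comp_apply, Ideal.Quotient.eq_zero_iff_mem.2 (Ideal.subset_span
      (Finset.mem_coe.2 (Finset.mem_image_of_mem _ (Finset.mem_univ j))))]
    exact RingHom.map_zero θ
  rw [← h1, map_sum]
  refine Finset.sum_congr rfl fun a _ => ?_
  have h2 : (MvPolynomial.X (j, a) : P) ⊗ₜ[ℤ] (AddMonoidAlgebra.single a 1 : L) =
      algebraMap P (P ⊗[ℤ] L) (MvPolynomial.X (j, a)) *
        Algebra.TensorProduct.includeRight (AddMonoidAlgebra.single a 1 : L) := by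
    simp [Algebra.TensorProduct.algebraMap_apply]
  have h3 : θ' (algebraMap P (P ⊗[ℤ] L) (MvPolynomial.X (j, a))) = c j a := by
    have : (θ.comp (algebraMap P ((P ⊗[ℤ] L) ⧸ 𝔞))) (MvPolynomial.X (j, a)) = c j a := by
      rw [hθ]
      exact MvPolynomial.aeval_X (R := ℤ) _ (j, a)
    exact this
  rw [h2, map_mul, h3]
  rfl

end Points

section Essential

variable {κ M : Type*} [AddCommGroup M]

/-- A subfamily of too small rank contains an essential subfamily. -/
lemma exists_isEssential_subset [Module.Finite ℤ M] [DecidableEq κ] (A : κ → Finset M) (I : Finset κ)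
    (hI : Module.finrank ℤ ↥(∑ j ∈ I, diffLattice (A j)) < I.card) :
    ∃ J ⊆ I, IsEssential A J := by
  induction I using Finset.strongInduction with
  | H I ih =>
  by_cases h : ∀ J ⊂ I, J.card ≤ Module.finrank ℤ ↥(∑ j ∈ J, diffLattice (A j))
  · refine ⟨I, subset_rfl, le_antisymm ?_ hI, h⟩
    obtain ⟨j, hj⟩ := Finset.card_pos.1 (by omega : 0 < I.card)
    have h1 := h _ (Finset.erase_ssubset hj)
    rw [Finset.card_erase_of_mem hj] at h1
    have h2 : Module.finrank ℤ ↥(∑ j ∈ I.erase j, diffLattice (A j)) ≤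
        Module.finrank ℤ ↥(∑ j ∈ I, diffLattice (A j)) := by
      refine Submodule.finrank_mono ?_
      rw [← Finset.add_sum_erase I _ hj]
      exact le_sup_right
    omega
  · push Not at h
    obtain ⟨J, hJ, hlt⟩ := h
    obtain ⟨K, hK, hess⟩ := ih J hJ hlt
    exact ⟨K, hK.trans hJ.1, hess⟩

lemma diffLattice_le_span [DecidableEq M] (A : Finset M) (a₀ : M) :
    diffLattice A ≤ Submodule.span ℤ (A.image (· - a₀) : Set M) := by
  refine Submodule.span_le.2 ?_
  rintro _ ⟨a, ha, b, hb, rfl⟩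
  rw [← sub_sub_sub_cancel_right a b a₀]
  exact Submodule.sub_mem _
    (Submodule.subset_span (Finset.mem_coe.2 (Finset.mem_image_of_mem _ ha)))
    (Submodule.subset_span (Finset.mem_coe.2 (Finset.mem_image_of_mem _ hb)))

/-- Families without essential subfamily impose no condition on generic coefficients. -/
lemma genericSolution_injective_of_forall_not_isEssential [Module.Finite ℤ M]
    [DecidableEq κ] [DecidableEq M] [IsDomain (AddMonoidAlgebra (MvPolynomial (κ × M) ℤ) M)]
    (A : κ → Finset M) (a₀ : κ → M) (I : Finset κ) (hI : ∀ J ⊆ I, ¬ IsEssential A J) :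
    Function.Injective (genericSolution A a₀ I) := by
  obtain ⟨v, hv, hli⟩ := exists_linearIndependent_transversal
    (fun j : I => (A j).image (· - a₀ j)) fun K => by
      have hK : K.map (Function.Embedding.subtype _) ⊆ I := by
        intro j hj
        obtain ⟨j, -, rfl⟩ := Finset.mem_map.1 hj
        exact j.2
      have h : ¬ Module.finrank ℤ ↥(∑ j ∈ K.map (Function.Embedding.subtype _),
          diffLattice (A j)) < (K.map (Function.Embedding.subtype _)).card := fun h =>
        let ⟨J, hJ, hess⟩ := exists_isEssential_subset A _ h
        hI J (hJ.trans hK) hess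
      rw [not_lt, Finset.card_map, Finset.sum_map] at h
      refine h.trans (Submodule.finrank_mono ?_)
      exact Finset.sum_induction _ (· ≤ _) (fun _ _ => sup_le) bot_le fun j hj =>
        (diffLattice_le_span _ _).trans (le_iSup₂_of_le j hj le_rfl)
  refine genericSolution_injective A a₀
    (fun j => if h : j ∈ I then v ⟨j, h⟩ + a₀ j else 0) I (fun j hj => ?_) ?_
  · obtain ⟨a, ha, hav⟩ := Finset.mem_image.1 (hv ⟨j, hj⟩)
    simp only [dif_pos hj, ← hav, sub_add_cancel]
    exact ha
  · convert hli using 2 with j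
    simp

/-- An irreducible relation on the incidence variety divides every other one, if omitting one
of the equations leaves the coefficients unconstrained. -/
lemma dvd_of_genericSolution_eq_zero [DecidableEq κ] [DecidableEq M]
    (A : κ → Finset M) (a₀ : κ → M) {I : Finset κ} {i : κ}
    (hinj : Function.Injective (genericSolution A a₀ (I.erase i)))
    {E G : MvPolynomial (κ × M) ℤ} (hE : Irreducible E) (hE0 : genericSolution A a₀ I E = 0)
    (hG : genericSolution A a₀ I G = 0) : E ∣ G := by
  by_contra hEG
  obtain ⟨a, b, r, hr, h⟩ := exists_lineShift_bezout hE hEG (Pi.single (i, a₀ i) 1)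
  let t := genericSolution A a₀ I (MvPolynomial.X (i, a₀ i)) -
    AddMonoidAlgebra.single 0 (MvPolynomial.X (i, a₀ i) : MvPolynomial (κ × M) ℤ)
  have hline : ∀ F, (lineShift (Pi.single (i, a₀ i) 1) F).eval₂
      (genericSolution A a₀ (I.erase i)) t = genericSolution A a₀ I F := by
    intro F
    rw [eval₂_lineShift]
    refine DFunLike.congr_fun (f := (MvPolynomial.aeval fun p =>
      genericSolution A a₀ (I.erase i) (MvPolynomial.X p) +
        (Pi.single (i, a₀ i) 1 : κ × M → ℤ) p * t).toRingHom)
      (MvPolynomial.ringHom_ext (fun r => by simp) fun p => ?_) F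
    change MvPolynomial.aeval _ (MvPolynomial.X p) = _
    rw [MvPolynomial.aeval_X]
    by_cases hp : p = (i, a₀ i)
    · subst hp
      rw [genericSolution_X_of_not A a₀ (p := (i, a₀ i)) fun h => Finset.notMem_erase _ _ h.1, Pi.single_eq_same,
        Int.cast_one, one_mul, add_sub_cancel]
    · rw [Pi.single_eq_of_ne hp, Int.cast_zero, zero_mul, add_zero]
      have hi : p.2 = a₀ p.1 → p.1 ≠ i := by
        rintro h' rfl
        exact hp (Prod.ext rfl h')
      simp only [genericSolution, MvPolynomial.eval₂Hom_X', Finset.mem_erase]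
      refine if_congr ?_ rfl rfl
      tauto
  have h' := congrArg (Polynomial.eval₂ (genericSolution A a₀ (I.erase i)) t) h
  rw [Polynomial.eval₂_add, Polynomial.eval₂_mul, Polynomial.eval₂_mul, hline, hline, hE0, hG,
    mul_zero, mul_zero, add_zero, Polynomial.eval₂_C] at h'
  exact hr ((map_eq_zero_iff _ hinj).1 h'.symm)

end Essential

lemma groupDeg_pos_iff (i : Fin (n + 1)) (R : MvPolynomial (Fin (n + 1) × (Fin n → ℤ)) ℤ) :
    0 < groupDeg i R ↔ ∃ p ∈ R.vars, p.1 = i := by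
  simp only [groupDeg, Finset.lt_sup_iff, MvPolynomial.mem_vars_iff_mem_support]
  constructor
  · rintro ⟨m, hm, h⟩
    obtain ⟨p, hp, -⟩ := Finset.exists_ne_zero_of_sum_ne_zero h.ne'
    rw [Finset.mem_filter] at hp
    exact ⟨p, ⟨m, hm, hp.1⟩, hp.2⟩
  · rintro ⟨p, ⟨m, hm, hp⟩, hpi⟩
    exact ⟨m, hm, Finset.sum_pos (fun q hq => Nat.pos_of_ne_zero
      (Finsupp.mem_support_iff.1 (Finset.mem_filter.1 hq).1)) ⟨p, Finset.mem_filter.2 ⟨hp, hpi⟩⟩⟩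

lemma continuous_evalCoeff (F : MvPolynomial (Fin (n + 1) × (Fin n → ℤ)) ℤ) :
    Continuous (evalCoeff F) := by
  have : evalCoeff F = fun c => MvPolynomial.eval (fun p => c p.1 p.2)
      (MvPolynomial.map (algebraMap ℤ ℂ) F) := by
    ext c
    rw [evalCoeff, MvPolynomial.aeval_def, MvPolynomial.eval₂_eq_eval_map]
  rw [this]
  exact (MvPolynomial.continuous_eval _).comp (by fun_prop)

lemma exists_seq_tendsto_of_evalCoeff_eq_zero
    {E G : MvPolynomial (Fin (n + 1) × (Fin n → ℤ)) ℤ} (hE : Irreducible E) (hEG : ¬ E ∣ G)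
    {c : Fin (n + 1) → (Fin n → ℤ) → ℂ} (hc : evalCoeff E c = 0) :
    ∃ x : ℕ → Fin (n + 1) → (Fin n → ℤ) → ℂ, Filter.Tendsto x Filter.atTop (nhds c) ∧
      ∀ k, evalCoeff E (x k) = 0 ∧ evalCoeff G (x k) ≠ 0 := by
  obtain ⟨x, hx, h⟩ := exists_seq_tendsto_of_not_dvd hE hEG _ hc
  refine ⟨fun k j a => x k (j, a), ?_, h⟩
  rw [tendsto_pi_nhds] at hx ⊢
  exact fun j => tendsto_pi_nhds.2 fun a => hx (j, a)

lemma MvPolynomial.vars_subset_of_dvd {σ R : Type*} [CommRing R] [NoZeroDivisors R] {P Q : MvPolynomial σ R}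
    (hQ : Q ≠ 0) (h : P ∣ Q) : P.vars ⊆ Q.vars := by
  classical
  obtain ⟨S, rfl⟩ := h
  intro p hp
  have hp' := MvPolynomial.degreeOf_mul_eq (n := p) (left_ne_zero_of_mul hQ)
    (right_ne_zero_of_mul hQ)
  rw [MvPolynomial.vars_def, Multiset.mem_toFinset, ← Multiset.count_pos,
    ← MvPolynomial.degreeOf_def] at hp ⊢
  omega

/-- The zero set of a generator of the ideal of relations is the closure of the set of
solvable systems. -/
lemma setOf_evalCoeff_eq_zero_eq_closure {A : Fin (n + 1) → Finset (Fin n → ℤ)}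
    {a₀ : Fin (n + 1) → Fin n → ℤ} (ha₀ : ∀ j, a₀ j ∈ A j)
    {E : MvPolynomial (Fin (n + 1) × (Fin n → ℤ)) ℤ} (hE : Irreducible E)
    (hker : ∀ F, genericSolution A a₀ Finset.univ F = 0 ↔ E ∣ F) :
    {c | evalCoeff E c = 0} = closure {c | HasRoot A c} := by
  apply subset_antisymm
  · intro c hc
    obtain ⟨H, hH0, hH⟩ := exists_genericSolution_ne_zero_forall_hasRoot ha₀
    obtain ⟨x, hx, h⟩ := exists_seq_tendsto_of_evalCoeff_eq_zero hE (mt (hker H).2 hH0) hc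
    refine mem_closure_of_tendsto hx (Filter.Eventually.of_forall fun k => hH _ ?_ (h k).2)
    intro F hF
    obtain ⟨Q, rfl⟩ := (hker F).1 hF
    have h1 := (h k).1
    rw [evalCoeff] at h1 ⊢
    rw [map_mul, h1, zero_mul]
  · exact closure_minimal
      (fun c hc => evalCoeff_eq_zero_of_genericSolution_eq_zero ha₀ ((hker E).2 dvd_rfl) hc)
      (isClosed_eq (continuous_evalCoeff E) continuous_const)

/-- **Nullstellensatz** for an irreducible integer polynomial with complex zeros. -/
lemma dvd_of_setOf_evalCoeff_eq_zero_subset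
    {E G : MvPolynomial (Fin (n + 1) × (Fin n → ℤ)) ℤ} (hE : Irreducible E)
    (hne : ∃ c, evalCoeff E c = 0)
    (h : {c | evalCoeff E c = 0} ⊆ {c | evalCoeff G c = 0}) : E ∣ G := by
  by_contra hEG
  obtain ⟨c, hc⟩ := hne
  obtain ⟨x, -, hx⟩ := exists_seq_tendsto_of_evalCoeff_eq_zero hE hEG hc
  exact (hx 0).2 (h (hx 0).1)

/-- If the essential subfamily is unique, the ideal of relations is generated by an irreducible
polynomial, which involves only the variables of the essential subfamily. -/
lemma exists_irreducible_ker_genericSolution {A : Fin (n + 1) → Finset (Fin n → ℤ)}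
    {a₀ : Fin (n + 1) → Fin n → ℤ} (ha₀ : ∀ j, a₀ j ∈ A j) {J : Finset (Fin (n + 1))}
    (hJ : IsEssential A J) (huniq : ∀ J', IsEssential A J' → J' = J) :
    ∃ E : MvPolynomial (Fin (n + 1) × (Fin n → ℤ)) ℤ, Irreducible E ∧
      (∀ F, genericSolution A a₀ Finset.univ F = 0 ↔ E ∣ F) ∧ ∀ p ∈ E.vars, p.1 ∈ J := by
  let L := ∑ j ∈ J, diffLattice (A j)
  let b := Module.finBasis ℤ L
  obtain ⟨F, hF0, hFJ, hF⟩ := exists_ne_zero_genericSolution_eq_zero A a₀ ha₀ Finset.univ J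
    (Finset.subset_univ J) (fun k => (b k : Fin n → ℤ))
    (by rw [Fintype.card_fin, hJ.1]; exact Nat.lt_succ_self _)
    (by
      intro j hj a ha
      have h1 : a - a₀ j ∈ L := by
        refine (?_ : diffLattice (A j) ≤ L) (Submodule.subset_span ⟨a, ha, _, ha₀ j, rfl⟩)
        simp only [L]
        rw [← Finset.add_sum_erase J _ hj]
        exact le_sup_left
      have h2 := Submodule.mem_map_of_mem (f := L.subtype)
        (b.span_eq.ge (Submodule.mem_top (x := (⟨_, h1⟩ : L))))
      rw [Submodule.map_span, ← Set.range_comp] at h2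
      exact h2)
  have hprime : (RingHom.ker (genericSolution A a₀ Finset.univ)).IsPrime := RingHom.ker_isPrime _
  obtain ⟨i, hi⟩ := Finset.card_pos.1 (by rw [hJ.1]; exact Nat.succ_pos _ : 0 < J.card)
  obtain ⟨E, hEfac, hE0⟩ : ∃ E ∈ UniqueFactorizationMonoid.factors F,
      E ∈ RingHom.ker (genericSolution A a₀ Finset.univ) := by
    obtain ⟨u, hu⟩ := UniqueFactorizationMonoid.factors_prod hF0
    rw [← RingHom.mem_ker, ← hu, Ideal.mul_unit_mem_iff_mem _ u.isUnit] at hF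
    exact (hprime.multiset_prod_mem_iff_exists_mem _).1 hF
  have hE := UniqueFactorizationMonoid.irreducible_of_factor E hEfac
  have hinj : Function.Injective (genericSolution A a₀ (Finset.univ.erase i)) :=
    genericSolution_injective_of_forall_not_isEssential A a₀ _ fun J' hJ' h =>
      Finset.notMem_erase i _ (hJ' ((huniq J' h).symm ▸ hi))
  refine ⟨E, hE, fun G => ⟨dvd_of_genericSolution_eq_zero A a₀ hinj hE hE0, ?_⟩, fun p hp => ?_⟩
  · rintro ⟨Q, rfl⟩
    rw [map_mul, RingHom.mem_ker.1 hE0, zero_mul]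
  · exact hFJ p (MvPolynomial.vars_subset_of_dvd hF0 (UniqueFactorizationMonoid.dvd_of_mem_factors hEfac) hp)

/-- Let `A_0, …, A_n` be nonempty finite subsets of `ℤ^n` with a
unique essential subfamily, indexed by `J` (so that the sparse eliminant is nontrivial).
Then the partial degree of the sparse eliminant in the group of variables `u_i` is
positive if and only if `i ∈ J`. -/
theorem groupDeg_eliminant_pos_iff_mem_essential
    (A : Fin (n + 1) → Finset (Fin n → ℤ)) (hA : ∀ i, (A i).Nonempty)
    (J : Finset (Fin (n + 1)))
    (hess : IsEssential A J ∧ ∀ J' : Finset (Fin (n + 1)), IsEssential A J' → J' = J)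
    (E : MvPolynomial (Fin (n + 1) × (Fin n → ℤ)) ℤ) (hE : IsEliminant A E)
    (i : Fin (n + 1)) :
    0 < groupDeg i E ↔ i ∈ J := by
  choose a₀ ha₀ using hA
  obtain ⟨E', hE', hker, hvars⟩ := exists_irreducible_ker_genericSolution ha₀ hess.1 hess.2
  have hV' := setOf_evalCoeff_eq_zero_eq_closure ha₀ hE' hker
  obtain ⟨hEirr, hV⟩ := hE.resolve_right fun h => h.2 E' ⟨hE', hV'⟩
  rw [← hV'] at hV
  have h0 : ∃ c, evalCoeff E' c = 0 := by
    have : (0 : Fin (n + 1) → (Fin n → ℤ) → ℂ) ∈ {c | evalCoeff E' c = 0} := by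
      rw [hV']
      exact subset_closure ⟨1, fun j => by simp⟩
    exact ⟨0, this⟩
  have hdvd : E' ∣ E := dvd_of_setOf_evalCoeff_eq_zero_subset hE' h0 hV.ge
  rw [groupDeg_pos_iff]
  constructor
  · rintro ⟨p, hp, rfl⟩
    exact hvars p (MvPolynomial.vars_subset_of_dvd hE'.ne_zero (hE'.dvd_symm hEirr hdvd) hp)
  · intro hi
    by_contra! hno
    have hinj : Function.Injective (genericSolution A a₀ (Finset.univ.erase i)) :=
      genericSolution_injective_of_forall_not_isEssential A a₀ _ fun J' hJ' h =>
        Finset.notMem_erase i _ (hJ' ((hess.2 J' h).symm ▸ hi))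
    have h1 : genericSolution A a₀ (Finset.univ.erase i) E =
        genericSolution A a₀ Finset.univ E := by
      refine MvPolynomial.hom_congr_vars (RingHom.ext fun r => by simp) (fun p hp _ => ?_) rfl
      simp only [genericSolution, MvPolynomial.eval₂Hom_X', Finset.mem_erase]
      exact if_congr (by simp [hno p hp]) rfl rfl
    rw [(hker E).2 hdvd] at h1
    exact hEirr.ne_zero ((map_eq_zero_iff _ hinj).1 h1)

end
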